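/- Define M(v, ξ) = |v|·K(ξ) + χ_{Ω₀}(ξ), where Ω₀ = [ρ₋, ρ₊], χ_{Ω₀} is the convex indicator (0 on Ω₀, +∞ off it), and K(ξ) = ∫₀¹ |ξ − W'(y)| dy with W' continuous, 1-periodic, zero-mean, and range Ω₀. Then M(v, ξ) ≥ ξ·v for all v, ξ ∈ ℝ, and equality holds exactly on the set ({0} × Ω₀) ∪ ((−∞,0) × {ρ₋}) ∪ ((0,+∞) × {ρ₊}). -/

import Mathlib

theorem integral_abs_sub_eq_of_le {f : ℝ → ℝ} (hf : Continuous f)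
    (hmean : ∫ y in (0:ℝ)..1, f y = 0) {ξ : ℝ} (h : ∀ y, f y ≤ ξ) :
    ∫ y in (0:ℝ)..1, |ξ - f y| = ξ := by
  have h1 : ∀ y, |ξ - f y| = ξ - f y := fun y => abs_of_nonneg (sub_nonneg.2 (h y))
  simp only [h1]
  rw [intervalIntegral.integral_sub intervalIntegrable_const (hf.intervalIntegrable _ _), hmean]
  simp

theorem lt_integral_abs_sub {f : ℝ → ℝ} (hf : Continuous f)
    (hmean : ∫ y in (0:ℝ)..1, f y = 0) {ξ : ℝ} (h : ∃ y ∈ Set.Icc (0:ℝ) 1, ξ < f y) :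
    ξ < ∫ y in (0:ℝ)..1, |ξ - f y| := by
  have hpos : 0 < ∫ y in (0:ℝ)..1, (|ξ - f y| - (ξ - f y)) := by
    refine intervalIntegral.integral_pos one_pos (by fun_prop)
      (fun y _ => sub_nonneg.2 (le_abs_self _)) ?_
    obtain ⟨y, hy, hlt⟩ := h
    exact ⟨y, hy, by linarith [abs_nonneg (ξ - f y)]⟩
  have hsub : ∫ y in (0:ℝ)..1, (ξ - f y) = ξ := by
    rw [intervalIntegral.integral_sub intervalIntegrable_const (hf.intervalIntegrable _ _), hmean]
    simp
  have habs : Continuous fun y => |ξ - f y| := by fun_prop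
  have hdiff : Continuous fun y => ξ - f y := by fun_prop
  rw [intervalIntegral.integral_sub (habs.intervalIntegrable _ _)
    (hdiff.intervalIntegrable _ _), hsub] at hpos
  linarith

/-- The limit dissipation density `M(v,ξ) = |v|·K(ξ) + χ_{[ρ₋,ρ₊]}(ξ)` satisfies
`M(v,ξ) ≥ ξ·v`, with equality exactly on
`({0} × [ρ₋,ρ₊]) ∪ ((−∞,0) × {ρ₋}) ∪ ((0,∞) × {ρ₊})`. -/
theorem stmt_7 (W' : ℝ → ℝ) (hc : Continuous W')
    (hper : ∀ y, W' (y + 1) = W' y)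
    (hmean : ∫ y in (0:ℝ)..1, W' y = 0)
    (ρp ρm : ℝ) (hρm : ρm < 0) (hρp : 0 < ρp)
    (hrange : Set.range W' = Set.Icc ρm ρp)
    (K : ℝ → ℝ) (hK : ∀ ξ, K ξ = ∫ y in (0:ℝ)..1, |ξ - W' y|)
    (M : ℝ → ℝ → EReal)
    (hM : ∀ v ξ, M v ξ =
      if ξ ∈ Set.Icc ρm ρp then ((|v| * K ξ : ℝ) : EReal) else ⊤) :
    (∀ v ξ : ℝ, ((ξ * v : ℝ) : EReal) ≤ M v ξ) ∧
      {p : ℝ × ℝ | M p.1 p.2 = ((p.2 * p.1 : ℝ) : EReal)} =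
        ({0} ×ˢ Set.Icc ρm ρp) ∪ (Set.Iio 0 ×ˢ {ρm}) ∪ (Set.Ioi 0 ×ˢ {ρp}) := by
  have hmem : ∀ y, W' y ∈ Set.Icc ρm ρp := fun y => hrange ▸ Set.mem_range_self y
  have hattain : ∀ r ∈ Set.Icc ρm ρp, ∃ y ∈ Set.Icc (0:ℝ) 1, W' y = r := by
    intro r hr
    obtain ⟨x, rfl⟩ : r ∈ Set.range W' := hrange ▸ hr
    have hp : Function.Periodic W' 1 := hper
    obtain ⟨y, hy, hxy⟩ := hp.exists_mem_Ico₀ one_pos x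
    exact ⟨y, Set.Ico_subset_Icc_self hy, hxy.symm⟩
  have hmean_neg : ∫ y in (0:ℝ)..1, -W' y = 0 := by
    rw [intervalIntegral.integral_neg, hmean, neg_zero]
  have hK_neg : ∀ ξ, K ξ = ∫ y in (0:ℝ)..1, |(-ξ) - (-W' y)| := by
    intro ξ
    rw [hK]
    congr 1
    ext y
    rw [← abs_neg]
    congr 1
    ring
  have hKp : K ρp = ρp := by
    rw [hK]
    exact integral_abs_sub_eq_of_le hc hmean fun y => (hmem y).2
  have hKm : K ρm = -ρm := by
    rw [hK_neg]
    exact integral_abs_sub_eq_of_le hc.neg hmean_neg fun y => neg_le_neg (hmem y).1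
  have hlt : ∀ ξ, ξ < ρp → ξ < K ξ := by
    intro ξ hξ
    rw [hK]
    obtain ⟨y, hy, hyp⟩ := hattain ρp ⟨by linarith, le_rfl⟩
    exact lt_integral_abs_sub hc hmean ⟨y, hy, hyp ▸ hξ⟩
  have hlt_neg : ∀ ξ, ρm < ξ → -ξ < K ξ := by
    intro ξ hξ
    rw [hK_neg]
    obtain ⟨y, hy, hym⟩ := hattain ρm ⟨le_rfl, by linarith⟩
    exact lt_integral_abs_sub hc.neg hmean_neg ⟨y, hy, by rw [Pi.neg_apply, hym]; exact neg_lt_neg hξ⟩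
  constructor
  · intro v ξ
    rw [hM]
    split_ifs with hξ
    · rw [EReal.coe_le_coe_iff]
      have h1 : ξ ≤ K ξ := by
        rcases hξ.2.eq_or_lt with rfl | h
        exacts [hKp.ge, (hlt ξ h).le]
      have h2 : -ξ ≤ K ξ := by
        rcases hξ.1.eq_or_lt with rfl | h
        exacts [hKm.ge, (hlt_neg ξ h).le]
      rcases le_total 0 v with hv | hv
      · rw [abs_of_nonneg hv]
        nlinarith
      · rw [abs_of_nonpos hv]
        nlinarith
    · exact le_top
  · ext ⟨v, ξ⟩
    simp only [Set.mem_ofPred_eq, Set.mem_union, Set.mem_prod, Set.mem_singleton_iff,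
      Set.mem_Iio, Set.mem_Ioi]
    rw [hM]
    constructor
    · intro h
      split_ifs at h with hξ
      · rw [EReal.coe_eq_coe_iff] at h
        rcases lt_trichotomy v 0 with hv | hv | hv
        · refine Or.inl (Or.inr ⟨hv, ?_⟩)
          by_contra hne
          have := hlt_neg ξ (lt_of_le_of_ne hξ.1 (Ne.symm hne))
          rw [abs_of_neg hv] at h
          nlinarith
        · exact Or.inl (Or.inl ⟨hv, hξ⟩)
        · refine Or.inr ⟨hv, ?_⟩
          by_contra hne
          have := hlt ξ (lt_of_le_of_ne hξ.2 hne)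
          rw [abs_of_pos hv] at h
          nlinarith
      · exact absurd h.symm (EReal.coe_ne_top _)
    · rintro ((⟨rfl, hξ⟩ | ⟨hv, rfl⟩) | ⟨hv, rfl⟩)
      · rw [if_pos hξ]
        simp
      · rw [if_pos ⟨le_rfl, by linarith⟩, hKm, abs_of_neg hv]
        congr 1
        ring
      · rw [if_pos ⟨by linarith, le_rfl⟩, hKp, abs_of_pos hv, mul_comm]
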